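/- Let n ≥ 3 and let Ω ⊂ ℝⁿ be a nonempty connected open set. The real vector space of smooth vector fields u : Ω → ℝⁿ satisfying l_{ij}(u) = 0 on Ω (the conformal Killing vectors of the flat metric on Ω) is finite-dimensional, of dimension at most (n+1)(n+2)/2. -/

import Mathlib

open MeasureTheory Finset

/-- Partial derivative `∂ᵢ f` of a scalar function on `ℝⁿ`. -/
noncomputable def pd {n : ℕ} (f : (Fin n → ℝ) → ℝ) (i : Fin n) (x : Fin n → ℝ) : ℝ :=
  fderiv ℝ f x (Pi.single i 1)

/-- Linearized strain tensor `e_{ij}(u) = (∂ᵢ u_j + ∂ⱼ u_i)/2`. -/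
noncomputable def strain {n : ℕ} (u : (Fin n → ℝ) → Fin n → ℝ) (i j : Fin n)
    (x : Fin n → ℝ) : ℝ :=
  (pd (fun y => u y j) i x + pd (fun y => u y i) j x) / 2

/-- The trace `e(u) = Σᵢ ∂ᵢ uᵢ`, i.e. the divergence of `u`. -/
noncomputable def diver {n : ℕ} (u : (Fin n → ℝ) → Fin n → ℝ) (x : Fin n → ℝ) : ℝ :=
  ∑ i, pd (fun y => u y i) i x

/-- Trace-free part `l_{ij}(u) = e_{ij}(u) − (1/n) e(u) δ_{ij}`. -/
noncomputable def ltf {n : ℕ} (u : (Fin n → ℝ) → Fin n → ℝ) (i j : Fin n)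
    (x : Fin n → ℝ) : ℝ :=
  strain u i j x - (1 / (n : ℝ)) * diver u x * (if i = j then 1 else 0)

theorem ContDiffOn.pd {n : ℕ} {Ω : Set (Fin n → ℝ)} (hΩ : IsOpen Ω) {f : (Fin n → ℝ) → ℝ}
    (hf : ContDiffOn ℝ (⊤ : ℕ∞) f Ω) (i : Fin n) : ContDiffOn ℝ (⊤ : ℕ∞) (pd f i) Ω :=
  (hf.fderiv_of_isOpen hΩ (by exact_mod_cast le_rfl)).clm_apply contDiffOn_const

theorem ContDiffOn.differentiableAt_of_isOpen {n : ℕ} {Ω : Set (Fin n → ℝ)} (hΩ : IsOpen Ω)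
    {f : (Fin n → ℝ) → ℝ} (hf : ContDiffOn ℝ (⊤ : ℕ∞) f Ω) {x : Fin n → ℝ} (hx : x ∈ Ω) :
    DifferentiableAt ℝ f x :=
  (hf.contDiffAt (hΩ.mem_nhds hx)).differentiableAt (by simp)

theorem pd_congr_of_eqOn {n : ℕ} {Ω : Set (Fin n → ℝ)} (hΩ : IsOpen Ω)
    {f g : (Fin n → ℝ) → ℝ} (h : Set.EqOn f g Ω) (i : Fin n) {x : Fin n → ℝ} (hx : x ∈ Ω) :
    pd f i x = pd g i x := by
  unfold pd
  rw [(h.eventuallyEq_of_mem (hΩ.mem_nhds hx)).fderiv_eq]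

theorem pd_add {n : ℕ} {f g : (Fin n → ℝ) → ℝ} {x : Fin n → ℝ} (hf : DifferentiableAt ℝ f x)
    (hg : DifferentiableAt ℝ g x) (i : Fin n) :
    pd (fun y => f y + g y) i x = pd f i x + pd g i x := by
  simp [pd, fderiv_fun_add hf hg]

theorem pd_const_mul {n : ℕ} {f : (Fin n → ℝ) → ℝ} {x : Fin n → ℝ} (hf : DifferentiableAt ℝ f x)
    (c : ℝ) (i : Fin n) : pd (fun y => c * f y) i x = c * pd f i x := by
  simp [pd, fderiv_const_mul hf c]

theorem pd_sum_const_mul {n : ℕ} {ι : Type*} [Fintype ι] {f : ι → (Fin n → ℝ) → ℝ}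
    {x : Fin n → ℝ} (hf : ∀ k, DifferentiableAt ℝ (f k) x) (c : ι → ℝ) (i : Fin n) :
    pd (fun y => ∑ k, c k * f k y) i x = ∑ k, c k * pd (f k) i x := by
  unfold pd
  rw [fderiv_fun_sum fun k _ => (hf k).const_mul (c k), _root_.sum_apply]
  exact Finset.sum_congr rfl fun k _ => pd_const_mul (hf k) (c k) i

theorem pd_comm {n : ℕ} {Ω : Set (Fin n → ℝ)} (hΩ : IsOpen Ω) {f : (Fin n → ℝ) → ℝ}
    (hf : ContDiffOn ℝ (⊤ : ℕ∞) f Ω) (i j : Fin n) {x : Fin n → ℝ} (hx : x ∈ Ω) :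
    pd (pd f i) j x = pd (pd f j) i x := by
  have hd : DifferentiableAt ℝ (fderiv ℝ f) x :=
    ((hf.fderiv_of_isOpen hΩ (m := (⊤ : ℕ∞)) (by exact_mod_cast le_rfl)).contDiffAt
      (hΩ.mem_nhds hx)).differentiableAt (by simp)
  have key : ∀ a b : Fin n, pd (pd f a) b x =
      fderiv ℝ (fderiv ℝ f) x (Pi.single b 1) (Pi.single a 1) := by
    intro a b
    unfold pd
    rw [fderiv_clm_apply hd (differentiableAt_const _)]
    simp
  have hs : IsSymmSndFDerivAt ℝ f x :=
    (hf.contDiffAt (hΩ.mem_nhds hx)).isSymmSndFDerivAt (by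
      rw [minSmoothness_of_isRCLikeNormedField]
      exact WithTop.coe_le_coe.2 (le_top : (2 : ℕ∞) ≤ ⊤))
  rw [key, key, hs.eq]

theorem eqOn_zero_of_pd_eq_zero {n : ℕ} {Ω : Set (Fin n → ℝ)} (hΩ : IsOpen Ω)
    (hconn : IsPreconnected Ω) {f : (Fin n → ℝ) → ℝ} (hf : ContDiffOn ℝ (⊤ : ℕ∞) f Ω)
    (h : ∀ x ∈ Ω, ∀ i, pd f i x = 0) {x₀ : Fin n → ℝ} (hx₀ : x₀ ∈ Ω) (h₀ : f x₀ = 0) :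
    ∀ x ∈ Ω, f x = 0 := by
  have hd : Set.EqOn (fderiv ℝ f) 0 Ω := by
    intro x hx
    refine ContinuousLinearMap.coe_injective (LinearMap.pi_ext' fun i => ?_)
    ext
    simpa [pd] using h x hx i
  intro x hx
  rw [hΩ.is_const_of_fderiv_eq_zero hconn (hf.differentiableOn (by simp)) hd hx hx₀, h₀]

theorem exists_ne_and_ne_fin {n : ℕ} (hn : 3 ≤ n) (i j : Fin n) :
    ∃ a : Fin n, a ≠ i ∧ a ≠ j := by
  obtain ⟨a, -, ha⟩ := Finset.exists_mem_notMem_of_card_lt_card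
    (s := ({i, j} : Finset (Fin n))) (t := Finset.univ)
    (Finset.card_le_two.trans_lt (by simpa using Nat.lt_of_succ_le hn))
  exact ⟨a, by simpa using ha⟩

section ConformalKilling

variable {n : ℕ} {Ω : Set (Fin n → ℝ)} {v : Fin n → (Fin n → ℝ) → ℝ} {g : (Fin n → ℝ) → ℝ}

theorem pd_pd_add_pd_pd_of_conformal (hΩ : IsOpen Ω) (hv : ∀ i, ContDiffOn ℝ (⊤ : ℕ∞) (v i) Ω)
    (hg : ContDiffOn ℝ (⊤ : ℕ∞) g Ω)
    (h : ∀ x ∈ Ω, ∀ i j, pd (v j) i x + pd (v i) j x = (if i = j then 2 else 0) * g x)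
    {x : Fin n → ℝ} (hx : x ∈ Ω) (i j k : Fin n) :
    pd (pd (v j) i) k x + pd (pd (v i) j) k x = (if i = j then 2 else 0) * pd g k x := by
  rw [← pd_const_mul (hg.differentiableAt_of_isOpen hΩ hx),
    ← pd_add (((hv j).pd hΩ i).differentiableAt_of_isOpen hΩ hx)
      (((hv i).pd hΩ j).differentiableAt_of_isOpen hΩ hx)]
  exact pd_congr_of_eqOn hΩ (fun y hy => h y hy i j) k hx

theorem pd_pd_eq_of_conformal (hΩ : IsOpen Ω) (hv : ∀ i, ContDiffOn ℝ (⊤ : ℕ∞) (v i) Ω)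
    (hg : ContDiffOn ℝ (⊤ : ℕ∞) g Ω)
    (h : ∀ x ∈ Ω, ∀ i j, pd (v j) i x + pd (v i) j x = (if i = j then 2 else 0) * g x)
    {x : Fin n → ℝ} (hx : x ∈ Ω) (i j k : Fin n) :
    pd (pd (v j) i) k x = (if i = j then 1 else 0) * pd g k x +
      ((if k = j then 1 else 0) * pd g i x + (if i = k then -1 else 0) * pd g j x) := by
  have h1 := pd_pd_add_pd_pd_of_conformal hΩ hv hg h hx i j k
  have h2 := pd_pd_add_pd_pd_of_conformal hΩ hv hg h hx k j i
  have h3 := pd_pd_add_pd_pd_of_conformal hΩ hv hg h hx i k j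
  rw [pd_comm hΩ (hv j) k i hx, pd_comm hΩ (hv k) j i hx] at h2
  rw [pd_comm hΩ (hv i) k j hx] at h3
  split_ifs at * <;> linarith

theorem pd_pd_factor_eq_zero_of_conformal (hn : 3 ≤ n) (hΩ : IsOpen Ω)
    (hv : ∀ i, ContDiffOn ℝ (⊤ : ℕ∞) (v i) Ω) (hg : ContDiffOn ℝ (⊤ : ℕ∞) g Ω)
    (h : ∀ x ∈ Ω, ∀ i j, pd (v j) i x + pd (v i) j x = (if i = j then 2 else 0) * g x)
    {x : Fin n → ℝ} (hx : x ∈ Ω) (i j : Fin n) : pd (pd g i) j x = 0 := by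
  have third : ∀ i j k l : Fin n, pd (pd (pd (v j) i) k) l x =
      (if i = j then 1 else 0) * pd (pd g k) l x +
      ((if k = j then 1 else 0) * pd (pd g i) l x +
        (if i = k then -1 else 0) * pd (pd g j) l x) := by
    intro i j k l
    have hd : ∀ m, DifferentiableAt ℝ (pd g m) x := fun m =>
      (hg.pd hΩ m).differentiableAt_of_isOpen hΩ hx
    rw [pd_congr_of_eqOn hΩ (fun y hy => pd_pd_eq_of_conformal hΩ hv hg h hy i j k) l hx,
      pd_add ((hd k).const_mul _) (((hd i).const_mul _).fun_add ((hd j).const_mul _)),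
      pd_add ((hd i).const_mul _) ((hd j).const_mul _), pd_const_mul (hd k),
      pd_const_mul (hd i), pd_const_mul (hd j)]
  have symm : ∀ i j k l : Fin n, pd (pd (pd (v j) i) k) l x = pd (pd (pd (v j) i) l) k x :=
    fun i j k l => pd_comm hΩ ((hv j).pd hΩ i) k l hx
  have swap : ∀ i j k l : Fin n, pd (pd (pd (v j) i) k) l x = pd (pd (pd (v j) k) i) l x :=
    fun i j k l => pd_congr_of_eqOn hΩ (fun y hy => pd_comm hΩ (hv j) i k hy) l hx
  have exch : ∀ i j k l : Fin n, pd (pd (pd (v j) i) k) l x = pd (pd (pd (v j) l) k) i x := by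
    intro i j k l
    rw [swap, symm, swap]
  obtain ⟨a, hai, haj⟩ := exists_ne_and_ne_fin hn i j
  by_cases hij : i = j
  · subst hij
    obtain ⟨b, hbi, hba⟩ := exists_ne_and_ne_fin hn i a
    have anti : ∀ p q : Fin n, p ≠ q → pd (pd g p) p x + pd (pd g q) q x = 0 := by
      intro p q hpq
      have e := exch p p q q
      rw [third, third] at e
      simp [hpq, hpq.symm] at e
      linarith
    linarith [anti i a hai.symm, anti i b hbi.symm, anti a b hba.symm]
  · have e := exch a a i j
    rw [third, third] at e
    simpa [hai, haj, hai.symm, haj.symm, hij, Ne.symm hij] using e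

theorem conformal_eq_zero_of_jet_eq_zero (hn : 3 ≤ n) (hΩ : IsOpen Ω) (hconn : IsPreconnected Ω)
    (hv : ∀ i, ContDiffOn ℝ (⊤ : ℕ∞) (v i) Ω) (hg : ContDiffOn ℝ (⊤ : ℕ∞) g Ω)
    (h : ∀ x ∈ Ω, ∀ i j, pd (v j) i x + pd (v i) j x = (if i = j then 2 else 0) * g x)
    {x₀ : Fin n → ℝ} (hx₀ : x₀ ∈ Ω) (h_v : ∀ i, v i x₀ = 0)
    (h_rot : ∀ i j, i < j → pd (v j) i x₀ = 0) (h_g : g x₀ = 0) (h_dg : ∀ i, pd g i x₀ = 0) :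
    ∀ x ∈ Ω, ∀ i, v i x = 0 := by
  have dg : ∀ i, ∀ x ∈ Ω, pd g i x = 0 := fun i =>
    eqOn_zero_of_pd_eq_zero hΩ hconn (hg.pd hΩ i)
      (fun x hx j => pd_pd_factor_eq_zero_of_conformal hn hΩ hv hg h hx i j) hx₀ (h_dg i)
  have dv₀ : ∀ i j, pd (v j) i x₀ = 0 := by
    intro i j
    have e := h x₀ hx₀ i j
    rw [h_g, mul_zero] at e
    rcases lt_trichotomy i j with hij | rfl | hij
    · exact h_rot i j hij
    · linarith
    · linarith [h_rot j i hij]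
  have dv : ∀ i j, ∀ x ∈ Ω, pd (v j) i x = 0 := fun i j =>
    eqOn_zero_of_pd_eq_zero hΩ hconn ((hv j).pd hΩ i)
      (fun x hx k => by simp [pd_pd_eq_of_conformal hΩ hv hg h hx, dg _ x hx]) hx₀ (dv₀ i j)
  exact fun x hx i =>
    eqOn_zero_of_pd_eq_zero hΩ hconn (hv i) (fun y hy j => dv j i y hy) hx₀ (h_v i) x hx

end ConformalKilling

theorem pd_add_pd_of_ltf_eq_zero {n : ℕ} {u : (Fin n → ℝ) → Fin n → ℝ} {x : Fin n → ℝ}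
    (h : ∀ i j, ltf u i j x = 0) (o i j : Fin n) :
    pd (fun y => u y j) i x + pd (fun y => u y i) j x =
      (if i = j then 2 else 0) * pd (fun y => u y o) o x := by
  have h1 := h i j
  have h2 := h o o
  simp only [ltf, strain] at h1 h2
  split_ifs at * with hij
  · linarith
  · linarith

/-- For `n ≥ 3` and a nonempty connected open `Ω ⊂ ℝⁿ`, the space of smooth vector fields
on `Ω` with `l_{ij}(u) = 0` (conformal Killing vectors of the flat metric) has dimension
at most `(n+1)(n+2)/2`: any family of `(n+1)(n+2)/2 + 1` such fields is linearly
dependent (as functions on `Ω`). -/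
theorem conformal_killing_finite_dimensional (n : ℕ) (hn : 3 ≤ n)
    (Ω : Set (Fin n → ℝ)) (hΩ : IsOpen Ω) (hconn : IsConnected Ω) :
    ∀ us : Fin ((n + 1) * (n + 2) / 2 + 1) → ((Fin n → ℝ) → Fin n → ℝ),
      (∀ k, ContDiffOn ℝ (⊤ : ℕ∞) (us k) Ω ∧ ∀ x ∈ Ω, ∀ i j, ltf (us k) i j x = 0) →
        ¬ LinearIndependent ℝ (fun k => Ω.restrict (us k)) := by
  intro us hus hli
  obtain ⟨x₀, hx₀⟩ := hconn.nonempty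
  let o : Fin n := ⟨0, by omega⟩
  let jet : Fin ((n + 1) * (n + 2) / 2 + 1) →
      (Fin n → ℝ) × ({p : Fin n × Fin n // p.1 < p.2} → ℝ) × ℝ × (Fin n → ℝ) := fun k =>
    (us k x₀, fun p => pd (fun y => us k y p.1.2) p.1.1 x₀, pd (fun y => us k y o) o x₀,
      fun i => pd (pd (fun y => us k y o) o) i x₀)
  have hjet : ¬ LinearIndependent ℝ jet := by
    intro hl
    have hc := hl.fintype_card_le_finrank
    simp only [Module.finrank_prod, Module.finrank_fintype_fun_eq_card, Module.finrank_self,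
      Fintype.card_fin, Fintype.card_subtype, Fintype.card_product_filter_lt, Nat.choose_two_right] at hc
    obtain ⟨m, rfl⟩ : ∃ m, n = m + 1 := ⟨n - 1, by omega⟩
    have e : (m + 1 + 1) * (m + 1 + 2) = (m + 1) * (m + 1 - 1) + 2 * (2 * m + 3) := by
      simp only [Nat.add_sub_cancel]; ring
    rw [e, Nat.add_mul_div_left _ _ two_pos] at hc
    omega
  obtain ⟨c, hc, k₀, hk₀⟩ := Fintype.not_linearIndependent_iff.1 hjet
  have hs : ∀ k i, ContDiffOn ℝ (⊤ : ℕ∞) (fun y => us k y i) Ω := fun k i =>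
    contDiffOn_pi.1 (hus k).1 i
  have hd : ∀ x ∈ Ω, ∀ k i, DifferentiableAt ℝ (fun y => us k y i) x := fun x hx k i =>
    (hs k i).differentiableAt_of_isOpen hΩ hx
  let v : Fin n → (Fin n → ℝ) → ℝ := fun i x => ∑ k, c k * us k x i
  have hv : ∀ i, ContDiffOn ℝ (⊤ : ℕ∞) (v i) Ω := fun i =>
    ContDiffOn.sum fun k _ => contDiffOn_const.mul (hs k i)
  have dv : ∀ i j, ∀ x ∈ Ω, pd (v j) i x = ∑ k, c k * pd (fun y => us k y j) i x :=
    fun i j x hx => pd_sum_const_mul (fun k => hd x hx k j) c i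
  have ddv : ∀ i, pd (pd (v o) o) i x₀ = ∑ k, c k * pd (pd (fun y => us k y o) o) i x₀ := by
    intro i
    rw [pd_congr_of_eqOn hΩ (dv o o) i hx₀]
    exact pd_sum_const_mul
      (fun k => ((hs k o).pd hΩ o).differentiableAt_of_isOpen hΩ hx₀) c i
  have h1 := congrArg Prod.fst hc
  have h2 := congrArg (fun z => z.2.1) hc
  have h3 := congrArg (fun z => z.2.2.1) hc
  have h4 := congrArg (fun z => z.2.2.2) hc
  simp only [jet, Prod.fst_sum, Prod.snd_sum, Prod.smul_fst, Prod.smul_snd, Prod.fst_zero,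
    Prod.snd_zero, smul_eq_mul] at h1 h2 h3 h4
  have hzero := conformal_eq_zero_of_jet_eq_zero (v := v) (g := pd (v o) o) hn hΩ
    hconn.isPreconnected hv ((hv o).pd hΩ o)
    (fun x hx i j => by
      rw [dv i j x hx, dv j i x hx, dv o o x hx, ← Finset.sum_add_distrib, Finset.mul_sum]
      refine Finset.sum_congr rfl fun k _ => ?_
      rw [← mul_add, pd_add_pd_of_ltf_eq_zero ((hus k).2 x hx) o]
      ring)
    hx₀ (fun i => by simpa using congrFun h1 i)
    (fun i j hij => by
      rw [dv i j x₀ hx₀]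
      simpa using congrFun h2 ⟨(i, j), hij⟩)
    (by rw [dv o o x₀ hx₀]; exact h3)
    (fun i => by rw [ddv i]; simpa using congrFun h4 i)
  refine hk₀ (Fintype.linearIndependent_iff.1 hli c ?_ k₀)
  ext x i
  simp only [Finset.sum_apply, Pi.smul_apply, smul_eq_mul]
  exact hzero x x.2 i
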